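/- arXiv:1512.00363 — 5 statements merged into one kernel-verified Lean document; each statement's English description precedes it below -/
import Mathlib

section
/- Let G be a simple graph with vertex set V and let P = (V_{u,v} | (u,v) ∈ V × V) be a T-partition system on G. If * is a binary operation on V such that for all u, v ∈ V, v ∈ V_{u, u*v} (i.e., u*v is the unique vertex w with v ∈ V_{u,w}), then (V,*) is a travel groupoid on G. -/
variable {V : Type*}

/-- The right translation system of a groupoid `(V, op)`:
`rts op u v = {w ∈ V | u * w = v}`. -/
def rts (op : V → V → V) (u v : V) : Set V := {w | op u w = v}

/-- Axiom (t1): `(u * v) * u = u` for all `u, v`. -/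
def T1 (op : V → V → V) : Prop := ∀ u v : V, op (op u v) u = u

/-- Axiom (t2): if `(u * v) * v = u` then `u = v`. -/
def T2 (op : V → V → V) : Prop := ∀ u v : V, op (op u v) v = u → u = v

/-- A travel groupoid: a groupoid satisfying (t1) and (t2). -/
def IsTravelGroupoid (op : V → V → V) : Prop := T1 op ∧ T2 op

/-- Axiom (t3) (simple): if `v * u ≠ u` then `u * (v * u) = u * v`. -/
def T3 (op : V → V → V) : Prop := ∀ u v : V, op v u ≠ u → op u (op v u) = op u v

/-- Axiom (t4) (smooth): if `u * v = u * w` then `u * (v * w) = u * v`. -/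
def T4 (op : V → V → V) : Prop := ∀ u v w : V, op u v = op u w → op u (op v w) = op u v

/-- Axiom (t5) (semi-smooth): if `u * v = u * w` then
`u * (v * w) = u * v` or `u * ((v * w) * w) = u * v`. -/
def T5 (op : V → V → V) : Prop :=
  ∀ u v w : V, op u v = op u w →
    op u (op v w) = op u v ∨ op u (op (op v w) w) = op u v

/-- A travel groupoid `(V, op)` is on the graph `G` if the edges of `G` are exactly
the pairs `{u, v}` with `u ≠ v` and `u * v = v`. -/
def IsOnGraph (op : V → V → V) (G : SimpleGraph V) : Prop :=
  ∀ u v : V, G.Adj u v ↔ u ≠ v ∧ op u v = v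

/-- The closed neighborhood `N_G[u]` of a vertex `u` in a graph `G`. -/
def closedNbhd (G : SimpleGraph V) (u : V) : Set V := insert u (G.neighborSet u)

/-- A T-partition system on a graph `G`: a family `P u v ⊆ V` indexed by pairs of
vertices satisfying (P0) (stated as: the sets `P u v` for `v ∈ N_G[u]` cover `V`
and are pairwise disjoint), (P1a), (P1b), (P1c), and (P2). -/
structure IsTPartitionSystem (G : SimpleGraph V) (P : V → V → Set V) : Prop where
  cover : ∀ u a : V, ∃ v ∈ closedNbhd G u, a ∈ P u v
  pairwise_disjoint : ∀ u : V, ∀ v ∈ closedNbhd G u, ∀ w ∈ closedNbhd G u,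
    v ≠ w → P u v ∩ P u w = ∅
  p1a : ∀ u : V, P u u = {u}
  p1b : ∀ u v : V, u ≠ v → (v ∈ P u v ↔ G.Adj u v)
  p1c : ∀ u v : V, u ≠ v → (P u v = ∅ ↔ ¬ G.Adj u v)
  p2 : ∀ u v : V, u ≠ v → P u v ∩ P v u = ∅

/-- Property (R3) (simple T-partition system). -/
def R3 (P : V → V → Set V) : Prop :=
  ∀ u v x y : V, u ∈ P v x → v ∈ P u y → u ≠ x → v ≠ y → x ∈ P u y ∧ y ∈ P v x

/-- Property (R4) (smooth T-partition system). -/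
def R4 (P : V → V → Set V) : Prop :=
  ∀ u v x y z : V, x ∈ P u v → y ∈ P u v → y ∈ P x z → z ∈ P u v

/-- Property (R5) (semi-smooth T-partition system). -/
def R5 (P : V → V → Set V) : Prop :=
  ∀ u v x y z w : V, x ∈ P u v → y ∈ P u v → y ∈ P x z ∩ P z w →
    z ∈ P u v ∨ w ∈ P u v

theorem IsTPartitionSystem.adj_of_mem {G : SimpleGraph V} {P : V → V → Set V}
    (hP : IsTPartitionSystem G P) {u w a : V} (ha : a ∈ P u w) (h : u ≠ w) : G.Adj u w := by
  by_contra hadj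
  have hempty := (hP.p1c u w h).2 hadj
  rw [hempty] at ha
  exact ha

theorem IsTPartitionSystem.mem_closedNbhd_of_mem {G : SimpleGraph V} {P : V → V → Set V}
    (hP : IsTPartitionSystem G P) {u w a : V} (ha : a ∈ P u w) : w ∈ closedNbhd G u := by
  by_cases h : u = w
  · exact Or.inl h.symm
  · exact Or.inr (hP.adj_of_mem ha h)

theorem IsTPartitionSystem.eq_of_mem {G : SimpleGraph V} {P : V → V → Set V}
    (hP : IsTPartitionSystem G P) {u v w a : V} (hv : a ∈ P u v) (hw : a ∈ P u w) : v = w := by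
  by_contra h
  have hdisj := hP.pairwise_disjoint u v (hP.mem_closedNbhd_of_mem hv) w
    (hP.mem_closedNbhd_of_mem hw) h
  exact Set.notMem_empty a (hdisj ▸ ⟨hv, hw⟩)

theorem stmt3 [Nonempty V] (G : SimpleGraph V) (P : V → V → Set V)
    (hP : IsTPartitionSystem G P) (op : V → V → V)
    (hop : ∀ u v : V, v ∈ P u (op u v)) :
    IsTravelGroupoid op ∧ IsOnGraph op G := by
  refine ⟨⟨fun u v => ?_, fun u v h => ?_⟩, fun u v => ⟨fun h => ?_, fun ⟨hne, h⟩ => ?_⟩⟩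
  · refine hP.eq_of_mem (hop _ _) ?_
    by_cases h : u = op u v
    · rw [← h, hP.p1a]
      rfl
    · exact (hP.p1b _ _ (Ne.symm h)).2 (hP.adj_of_mem (hop u v) h).symm
  · have hu := hop u v
    have hw := hop (op u v) v
    rw [h] at hw
    by_cases hne : u = op u v
    · rw [← hne, hP.p1a] at hu
      exact hu.symm
    · have hmem : v ∈ P u (op u v) ∩ P (op u v) u := ⟨hu, hw⟩
      rw [hP.p2 _ _ hne] at hmem
      exact hmem.elim
  · exact ⟨h.ne, hP.eq_of_mem (hop u v) ((hP.p1b u v h.ne).2 h)⟩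
  · have hv := hop u v
    rw [h] at hv
    exact (hP.p1b u v hne).1 hv
end

section
/- Let G be a simple graph with vertex set V. Then the map sending a travel groupoid (V,*) on G to its right translation system is a bijection between the set of all travel groupoids on G (i.e., binary operations * on V making (V,*) a travel groupoid on G) and the set of all T-partition systems on G. -/
variable {V : Type*}

namespace IsTravelGroupoid

variable {op : V → V → V}

theorem op_self (h : IsTravelGroupoid op) (u : V) : op u u = u := by
  apply h.2
  rw [h.1 u u]

theorem eq_of_op_eq_left (h : IsTravelGroupoid op) {u v : V} (huv : op u v = u) : u = v := by
  apply h.2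
  rw [huv, huv]

theorem op_op (h : IsTravelGroupoid op) (u v : V) : op u (op u v) = op u v := by
  simpa [h.1 u v] using h.1 (op u v) u

theorem op_mem_closedNbhd (h : IsTravelGroupoid op) {G : SimpleGraph V} (hG : IsOnGraph op G)
    (u v : V) : op u v ∈ closedNbhd G u := by
  by_cases huv : op u v = u
  · exact Or.inl huv
  · exact Or.inr ((hG _ _).2 ⟨Ne.symm huv, h.op_op u v⟩)

theorem isTPartitionSystem_rts (h : IsTravelGroupoid op) {G : SimpleGraph V}
    (hG : IsOnGraph op G) : IsTPartitionSystem G (rts op) where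
  cover u a := ⟨op u a, h.op_mem_closedNbhd hG u a, rfl⟩
  pairwise_disjoint u v _ w _ hvw :=
    Set.eq_empty_of_forall_notMem fun _ hx => hvw (hx.1.symm.trans hx.2)
  p1a u := by
    ext w
    constructor
    · exact fun hw => (h.eq_of_op_eq_left hw).symm
    · rintro rfl
      exact h.op_self _
  p1b u v huv := ⟨fun hv => (hG u v).2 ⟨huv, hv⟩, fun hv => ((hG u v).1 hv).2⟩
  p1c u v huv := by
    constructor
    · intro hempty hadj
      exact Set.eq_empty_iff_forall_notMem.1 hempty v ((hG u v).1 hadj).2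
    · refine fun hadj => Set.eq_empty_of_forall_notMem ?_
      rintro w rfl
      exact hadj ((hG u _).2 ⟨huv, h.op_op u w⟩)
  p2 u v huv := by
    refine Set.eq_empty_of_forall_notMem ?_
    rintro w ⟨rfl, hw⟩
    obtain rfl := h.2 u w hw
    exact huv (h.op_self u).symm

end IsTravelGroupoid

namespace IsTPartitionSystem

variable {G : SimpleGraph V} {P : V → V → Set V}

theorem adj_of_mem_s5 (h : IsTPartitionSystem G P) {u v w : V} (huv : u ≠ v) (hw : w ∈ P u v) :
    G.Adj u v := by
  by_contra hadj
  simp [(h.p1c u v huv).2 hadj] at hw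

theorem mem_closedNbhd_of_mem_s5 (h : IsTPartitionSystem G P) {u v w : V} (hw : w ∈ P u v) :
    v ∈ closedNbhd G u := by
  by_cases huv : u = v
  · exact Or.inl huv.symm
  · exact Or.inr (h.adj_of_mem_s5 huv hw)

theorem eq_of_mem_of_mem (h : IsTPartitionSystem G P) {u v v' w : V} (hv : w ∈ P u v)
    (hv' : w ∈ P u v') : v = v' := by
  by_contra hne
  exact Set.eq_empty_iff_forall_notMem.1 (h.pairwise_disjoint u v (h.mem_closedNbhd_of_mem_s5 hv)
    v' (h.mem_closedNbhd_of_mem_s5 hv') hne) w ⟨hv, hv'⟩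

theorem exists_rts_eq (h : IsTPartitionSystem G P) : ∃ op : V → V → V, rts op = P := by
  choose op _ hop using h.cover
  refine ⟨op, ?_⟩
  ext u v w
  constructor
  · rintro rfl
    exact hop u w
  · exact fun hw => h.eq_of_mem_of_mem (hop u w) hw

theorem isTravelGroupoid {op : V → V → V} (h : IsTPartitionSystem G (rts op)) :
    IsTravelGroupoid op := by
  have op_self (u : V) : op u u = u := show u ∈ rts op u u by rw [h.p1a]; rfl
  have eq_of_op_eq_left {u v : V} (huv : op u v = u) : v = u := by
    have hv : v ∈ rts op u u := huv
    rwa [h.p1a] at hv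
  constructor
  · intro u v
    by_cases huv : u = op u v
    · rw [← huv, op_self]
    · exact (h.p1b _ _ (Ne.symm huv)).2 (h.adj_of_mem_s5 (w := v) huv rfl).symm
  · intro u v huv
    by_cases hne : u = op u v
    · exact (eq_of_op_eq_left hne.symm).symm
    · exact (Set.eq_empty_iff_forall_notMem.1 (h.p2 u (op u v) hne) v ⟨rfl, huv⟩).elim

theorem isOnGraph {op : V → V → V} (h : IsTPartitionSystem G (rts op)) : IsOnGraph op G :=
  fun u v => ⟨fun hadj => ⟨hadj.ne, (h.p1b u v hadj.ne).2 hadj⟩,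
    fun ⟨hne, hop⟩ => (h.p1b u v hne).1 hop⟩

end IsTPartitionSystem

theorem rts_injective : Function.Injective (rts : (V → V → V) → V → V → Set V) := by
  intro op op' h
  funext u v
  have hv : v ∈ rts op u (op u v) := rfl
  rw [h] at hv
  exact hv.symm

theorem stmt5 [Nonempty V] (G : SimpleGraph V) :
    Set.BijOn (fun op : V → V → V => rts op)
      {op : V → V → V | IsTravelGroupoid op ∧ IsOnGraph op G}
      {P : V → V → Set V | IsTPartitionSystem G P} := by
  refine ⟨fun op h => h.1.isTPartitionSystem_rts h.2, rts_injective.injOn, fun P hP => ?_⟩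
  obtain ⟨op, rfl⟩ := IsTPartitionSystem.exists_rts_eq hP
  exact ⟨op, ⟨IsTPartitionSystem.isTravelGroupoid hP, IsTPartitionSystem.isOnGraph hP⟩, rfl⟩
end

section
/- Let (V,*) be a travel groupoid and for u, v ∈ V let V_{u,v} = {w ∈ V | u*w = v}. Then (V,*) is simple if and only if for all u, v, x, y ∈ V: if u ∈ V_{v,x}, v ∈ V_{u,y}, u ≠ x, and v ≠ y, then x ∈ V_{u,y} and y ∈ V_{v,x}. -/
variable {V : Type*}

theorem stmt6 [Nonempty V] (op : V → V → V) (hTG : IsTravelGroupoid op) :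
    T3 op ↔ R3 (rts op) := by
  constructor
  · intro h u v x y hx hy hux hvy
    obtain rfl : op v u = x := hx
    obtain rfl : op u v = y := hy
    exact ⟨h u v hux.symm, h v u hvy.symm⟩
  · intro h u v hne
    refine (h u v (op v u) (op u v) rfl rfl hne.symm fun hv => hne ?_).1
    have h₁ := hTG.1 u v
    rwa [← hv] at h₁
end

section
/- Let G be a simple graph and let (V,*) be a simple travel groupoid on G. Then the right translation system of (V,*), given by V_{u,v} = {w ∈ V | u*w = v}, is a simple T-partition system on G. -/
variable {V : Type*}

theorem T1.op_op_self {op : V → V → V} (h : T1 op) (u v : V) : op u (op u v) = op u v := by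
  simpa only [h u v] using h (op u v) u

theorem IsTravelGroupoid.op_self_s8 {op : V → V → V} (h : IsTravelGroupoid op) (u : V) :
    op u u = u :=
  h.2 _ _ (by rw [h.1 u u])

theorem IsTravelGroupoid.eq_of_op_eq_left_s8 {op : V → V → V} (h : IsTravelGroupoid op) {u v : V}
    (huv : op u v = u) : u = v :=
  h.2 _ _ (by rw [huv, huv])

theorem stmt8 [Nonempty V] (G : SimpleGraph V) (op : V → V → V)
    (hTG : IsTravelGroupoid op) (hT3 : T3 op) (hOn : IsOnGraph op G) :
    IsTPartitionSystem G (rts op) ∧ R3 (rts op) := by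
  refine ⟨⟨fun u a => ?_, fun u v _ w _ hvw => ?_, fun u => ?_, fun u v huv => ?_,
    fun u v huv => ?_, fun u v huv => ?_⟩, ?_⟩
  · refine ⟨op u a, ?_, rfl⟩
    by_cases h : op u a = u
    · exact Or.inl h
    · exact Or.inr ((hOn _ _).2 ⟨Ne.symm h, hTG.1.op_op_self u a⟩)
  · ext a
    simp only [Set.mem_inter_iff, Set.mem_empty_iff_false, iff_false]
    rintro ⟨rfl, h⟩
    exact hvw h
  · ext a
    constructor
    · exact fun h => (hTG.eq_of_op_eq_left_s8 h).symm
    · rintro rfl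
      exact hTG.op_self_s8 a
  · exact ⟨fun h => (hOn u v).2 ⟨huv, h⟩, fun h => ((hOn u v).1 h).2⟩
  · rw [← not_iff_not, not_not, ← Ne.eq_def, ← Set.nonempty_iff_ne_empty]
    constructor
    · rintro ⟨w, rfl⟩
      exact (hOn _ _).2 ⟨huv, hTG.1.op_op_self u w⟩
    · exact fun h => ⟨v, ((hOn u v).1 h).2⟩
  · ext a
    simp only [Set.mem_inter_iff, Set.mem_empty_iff_false, iff_false]
    rintro ⟨rfl, h⟩
    obtain rfl := hTG.2 u a h
    exact huv (hTG.op_self_s8 u).symm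
  · rintro u v _ _ rfl rfl hu hv
    exact ⟨hT3 u v hu.symm, hT3 v u hv.symm⟩
end

section
/- Let G be a simple graph and let (V,*) be a semi-smooth travel groupoid on G. Then the right translation system of (V,*), given by V_{u,v} = {w ∈ V | u*w = v}, is a semi-smooth T-partition system on G. -/
variable {V : Type*}

namespace IsTravelGroupoid

variable {op : V → V → V}

theorem op_eq_left_iff (h : IsTravelGroupoid op) {u v : V} : op u v = u ↔ u = v := by
  refine ⟨fun huv => h.2 u v (by rw [huv, huv]), ?_⟩
  rintro rfl
  exact h.op_self u

end IsTravelGroupoid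

theorem T5.r5_rts {op : V → V → V} (h : T5 op) : R5 (rts op) := by
  rintro u _ x y _ _ rfl hy ⟨rfl, rfl⟩
  exact h u x y (Eq.symm hy)

theorem stmt16 [Nonempty V] (G : SimpleGraph V) (op : V → V → V)
    (hTG : IsTravelGroupoid op) (hT5 : T5 op) (hOn : IsOnGraph op G) :
    IsTPartitionSystem G (rts op) ∧ R5 (rts op) :=
  ⟨hTG.isTPartitionSystem_rts hOn, hT5.r5_rts⟩
end
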